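/- Let X be a G-space with basepoint o. If some element of G is strongly contracting for the action of G on X, then every infinite normal subgroup of G contains an element that is strongly contracting for the action of G on X. -/

import Mathlib

open Filter Metric
open scoped ENNReal

section Defs

variable {G : Type*} {X : Type*} [Group G] [MetricSpace X] [MulAction G X]

/-- A geodesic from `x` to `y`: an isometric parameterization of `[0, dist x y]`. -/
def GeodesicFromTo (γ : ℝ → X) (x y : X) : Prop :=
  γ 0 = x ∧ γ (dist x y) = y ∧
    ∀ s ∈ Set.Icc (0 : ℝ) (dist x y), ∀ t ∈ Set.Icc (0 : ℝ) (dist x y),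
      dist (γ s) (γ t) = |s - t|

/-- A geodesic metric space. -/
def GeodesicSpace (X : Type*) [MetricSpace X] : Prop :=
  ∀ x y : X, ∃ γ : ℝ → X, GeodesicFromTo γ x y

/-- The action of `G` on `X` is by isometries. -/
def IsometricAction (G X : Type*) [Group G] [MetricSpace X] [MulAction G X] : Prop :=
  ∀ (g : G) (x y : X), dist (g • x) (g • y) = dist x y

/-- The action of `G` on `X` is properly discontinuous. -/
def ProperlyDiscontinuousAction (G X : Type*) [Group G] [MetricSpace X] [MulAction G X] : Prop :=
  ∀ K : Set X, IsCompact K → {g : G | ((g • ·) '' K ∩ K).Nonempty}.Finite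

/-- `G` is non-elementary: no cyclic subgroup has finite index. -/
def NonElementary (G : Type*) [Group G] : Prop :=
  ∀ g : G, (Subgroup.zpowers g).index = 0

/-- Growth exponent of a subset `A ⊆ G`, with respect to basepoint `o`. -/
noncomputable def growthExp (o : X) (A : Set G) : ℝ≥0∞ :=
  Filter.limsup (fun r : ℝ =>
    ENNReal.ofReal (Real.log (Nat.card {g : G // g ∈ A ∧ dist o (g • o) ≤ r}) / r))
    Filter.atTop

/-- Growth exponent of the quotient `G ⧸ Γ` with the induced pseudo-metric. -/
noncomputable def quotGrowthExp (o : X) (Γ : Subgroup G) : ℝ≥0∞ :=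
  Filter.limsup (fun r : ℝ =>
    ENNReal.ofReal (Real.log (Nat.card
      {q : G ⧸ Γ // ∃ g : G, QuotientGroup.mk g = q ∧ (⨅ γ : Γ, dist o ((g * γ) • o)) ≤ r}) / r))
    Filter.atTop

/-- A growth tight action. -/
def GrowthTight (G : Type*) [Group G] {X : Type*} [MetricSpace X] [MulAction G X] (o : X) : Prop :=
  ∀ Γ : Subgroup G, Γ.Normal → (Γ : Set G).Infinite →
    quotGrowthExp o Γ < growthExp o (Set.univ : Set G)

/-- The `⟨h⟩`-orbit of the basepoint. -/
def zOrbit (o : X) (h : G) : Set X := Set.range fun i : ℤ => h ^ i • o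

/-- Nearest point projection to a subset. -/
def nprojSet (S : Set X) (x : X) : Set X := {a ∈ S | dist x a = Metric.infDist x S}

/-- `h` is a strongly contracting element for `G ↷ X`. -/
def StronglyContractingElem (o : X) (h : G) : Prop :=
  ¬ IsOfFinOrder h ∧
  (∃ M C : ℝ, 1 ≤ M ∧ 0 ≤ C ∧ ∀ i j : ℤ,
    (1 / M) * |(i : ℝ) - (j : ℝ)| - C ≤ dist (h ^ i • o) (h ^ j • o) ∧
    dist (h ^ i • o) (h ^ j • o) ≤ M * |(i : ℝ) - (j : ℝ)| + C) ∧
  (∃ C : ℝ, 0 ≤ C ∧ ∀ x y : X,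
    dist x y < Metric.infDist x (zOrbit o h) - C →
    Metric.diam (nprojSet (zOrbit o h) x ∪ nprojSet (zOrbit o h) y) ≤ C)

end Defs

section Helpers

open scoped Pointwise

variable {G X : Type*} [Group G] [MetricSpace X] [MulAction G X]

theorem mem_nprojSet_self {S : Set X} {a : X} (ha : a ∈ S) : a ∈ nprojSet S a :=
  ⟨ha, by rw [dist_self, infDist_zero_of_mem ha]⟩

theorem dist_le_of_mem_nprojSet {S : Set X} {x p a : X} (hp : p ∈ nprojSet S x) (ha : a ∈ S) :
    dist x p ≤ dist x a :=
  hp.2.trans_le (infDist_le_dist_of_mem ha)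

theorem smul_mem_nprojSet_smul [IsIsometricSMul G X] {S : Set X} {x p : X} (g : G)
    (hp : p ∈ nprojSet S x) : g • p ∈ nprojSet (g • S) (g • x) := by
  refine ⟨Set.smul_mem_smul_set hp.1, ?_⟩
  rw [dist_smul, hp.2]
  exact (infDist_image (isometry_smul X g)).symm

theorem mem_nprojSet_of_smul [IsIsometricSMul G X] {S : Set X} {x p : X} (g : G)
    (hp : p ∈ nprojSet (g • S) x) : g⁻¹ • p ∈ nprojSet S (g⁻¹ • x) := by
  simpa using smul_mem_nprojSet_smul g⁻¹ hp

/-- Nearest-point projections to `S` exist, and two points whose projections are more than `c`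
apart are joined, up to an additive error `c`, by a geodesic through these projections. -/
def ProjectionBottleneck (c : ℝ) (S : Set X) : Prop :=
  (∀ x, (nprojSet S x).Nonempty) ∧ ∀ x y p q, p ∈ nprojSet S x → q ∈ nprojSet S y →
    c < dist p q → dist x p + dist p q + dist q y ≤ dist x y + c

theorem ProjectionBottleneck.smul [IsIsometricSMul G X] {c : ℝ} {S : Set X}
    (hS : ProjectionBottleneck c S) (g : G) : ProjectionBottleneck c (g • S) := by
  refine ⟨fun x => ?_, fun x y p q hp hq hpq => ?_⟩
  · obtain ⟨p, hp⟩ := hS.1 (g⁻¹ • x)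
    exact ⟨g • p, by simpa using smul_mem_nprojSet_smul g hp⟩
  · have := hS.2 _ _ _ _ (mem_nprojSet_of_smul g hp) (mem_nprojSet_of_smul g hq)
      (by rwa [dist_smul])
    simpa only [dist_smul] using this

theorem ProjectionBottleneck.dist_add_dist_le {c : ℝ} {S : Set X}
    (hS : ProjectionBottleneck c S) {x p a : X} (hp : p ∈ nprojSet S x) (ha : a ∈ S) :
    dist x p + dist p a ≤ dist x a + c := by
  have h1 := dist_le_of_mem_nprojSet hp ha
  by_cases h : c < dist p a
  · have := hS.2 _ _ _ _ hp (mem_nprojSet_self ha) h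
    simpa using this
  · linarith

theorem ProjectionBottleneck.dist_le_of_between {c e : ℝ} {S : Set X}
    (hS : ProjectionBottleneck c S) {a b z r : X} (ha : a ∈ S) (hb : b ∈ S)
    (hr : r ∈ nprojSet S z) (hz : dist a z + dist z b ≤ dist a b + e) :
    2 * dist z r ≤ 2 * c + e := by
  have h1 := hS.dist_add_dist_le hr ha
  have h2 := hS.dist_add_dist_le hr hb
  have h3 := dist_triangle a r b
  rw [dist_comm z a, dist_comm r a] at h1
  linarith

/-- The Behrstock inequality for a pair of sets. -/
theorem ProjectionBottleneck.behrstock {c : ℝ} {S₁ S₂ : Set X}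
    (h₁ : ProjectionBottleneck c S₁) (h₂ : ProjectionBottleneck c S₂) {x p q r s : X}
    (hp : p ∈ nprojSet S₁ x) (hq : q ∈ nprojSet S₂ x) (hr : r ∈ nprojSet S₁ q)
    (hs : s ∈ nprojSet S₂ p) : dist p r ≤ c ∨ dist q s ≤ c := by
  by_contra! hcon
  have h3 := h₁.2 _ _ _ _ hp hr hcon.1
  have h4 := h₂.2 _ _ _ _ hq hs hcon.2
  have := dist_nonneg (x := r) (y := q)
  have := dist_nonneg (x := s) (y := p)
  linarith

/-- The projection of `S'` to `S` lies in the `T`-ball about `a`. -/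
def ProjectsNear (S S' : Set X) (a : X) (T : ℝ) : Prop :=
  ∀ y ∈ S', ∀ p ∈ nprojSet S y, dist p a ≤ T

theorem ProjectsNear.smul [IsIsometricSMul G X] {S S' : Set X} {a : X} {T : ℝ}
    (hS : ProjectsNear S S' a T) (g : G) : ProjectsNear (g • S) (g • S') (g • a) T := by
  rintro _ ⟨y, hy, rfl⟩ p hp
  have := hS y hy (g⁻¹ • p) (by simpa using mem_nprojSet_of_smul g hp)
  rwa [← dist_smul g, smul_inv_smul] at this

theorem ProjectsNear.chain {c T : ℝ} {S₁ S₂ S₃ : Set X} {a b b' : X}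
    (h₁ : ProjectionBottleneck c S₁) (h₂ : ProjectionBottleneck c S₂)
    (h₁₂ : ProjectsNear S₁ S₂ a T) (h₂₁ : ProjectsNear S₂ S₁ b T)
    (h₂₃ : ProjectsNear S₂ S₃ b' T) (hb : 2 * T + c < dist b b') :
    ProjectsNear S₁ S₃ a (T + c) := by
  intro x hx p hp
  obtain ⟨q, hq⟩ := h₂.1 x
  obtain ⟨r, hr⟩ := h₁.1 q
  obtain ⟨s, hs⟩ := h₂.1 p
  have hqb := h₂₃ x hx q hq
  have hsb := h₂₁ p hp.1 s hs
  have hra := h₁₂ q hq.1 r hr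
  rcases h₁.behrstock h₂ hp hq hr hs with h | h
  · linarith [dist_triangle p r a]
  · have := dist_triangle4 b s q b'
    rw [dist_comm b s, dist_comm s q] at this
    linarith

/-! ### Contracting sets in geodesic spaces -/

theorem dist_nprojSet_le_of_far {C ℓ : ℝ} (hC : 0 ≤ C) {S : Set X}
    (hne : ∀ x, (nprojSet S x).Nonempty)
    (hS : ∀ x y, dist x y < infDist x S - C → ∀ p ∈ nprojSet S x, ∀ q ∈ nprojSet S y,
      dist p q ≤ C)
    {γ : ℝ → X} (hγ : ∀ s ∈ Set.Icc 0 ℓ, ∀ t ∈ Set.Icc 0 ℓ, dist (γ s) (γ t) = |s - t|)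
    (hfar : ∀ t ∈ Set.Icc 0 ℓ, 3 * C + 2 ≤ infDist (γ t) S) (n : ℕ) :
    ∀ s ∈ Set.Icc 0 ℓ, ∀ t ∈ Set.Icc 0 ℓ, s ≤ t → t - s ≤ (n + 1) * (2 * C + 1) →
      ∀ p ∈ nprojSet S (γ s), ∀ q ∈ nprojSet S (γ t), dist p q ≤ (n + 1) * C := by
  have base : ∀ s ∈ Set.Icc 0 ℓ, ∀ t ∈ Set.Icc 0 ℓ, s ≤ t → t - s ≤ 2 * C + 1 →
      ∀ p ∈ nprojSet S (γ s), ∀ q ∈ nprojSet S (γ t), dist p q ≤ C := by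
    intro s hs t ht hst h1 p hp q hq
    refine hS _ _ ?_ p hp q hq
    rw [hγ s hs t ht, abs_sub_comm, abs_of_nonneg (by linarith)]
    linarith [hfar s hs]
  induction n with
  | zero => simpa using base
  | succ n ih =>
    intro s hs t ht hst h1 p hp q hq
    push_cast at h1 ⊢
    by_cases h2 : t - s ≤ 2 * C + 1
    · have := base s hs t ht hst h2 p hp q hq
      have : 0 ≤ (n + 1) * C := by positivity
      linarith
    · have hm : t - (2 * C + 1) ∈ Set.Icc 0 ℓ := ⟨by linarith [hs.1], by linarith [ht.2]⟩
      obtain ⟨r, hr⟩ := hne (γ (t - (2 * C + 1)))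
      have h3 := ih s hs _ hm (by linarith) (by linarith) p hp r hr
      have h4 := base _ hm t ht (by linarith) (by linarith) r hr q hq
      linarith [dist_triangle p r q]

theorem dist_nprojSet_le_of_geodesic_far {C ℓ : ℝ} (hC : 0 ≤ C) (hℓ : 0 ≤ ℓ) {S : Set X}
    (hne : ∀ x, (nprojSet S x).Nonempty)
    (hS : ∀ x y, dist x y < infDist x S - C → ∀ p ∈ nprojSet S x, ∀ q ∈ nprojSet S y,
      dist p q ≤ C)
    {γ : ℝ → X} (hγ : ∀ s ∈ Set.Icc 0 ℓ, ∀ t ∈ Set.Icc 0 ℓ, dist (γ s) (γ t) = |s - t|)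
    (hfar : ∀ t ∈ Set.Icc 0 ℓ, 3 * C + 2 ≤ infDist (γ t) S) {p q : X}
    (hp : p ∈ nprojSet S (γ 0)) (hq : q ∈ nprojSet S (γ ℓ)) : dist p q ≤ 8 * C + 2 := by
  have h0 : (0 : ℝ) ∈ Set.Icc 0 ℓ := ⟨le_rfl, hℓ⟩
  have hl : ℓ ∈ Set.Icc 0 ℓ := ⟨hℓ, le_rfl⟩
  have f0 := hfar 0 h0
  have fl := hfar ℓ hl
  have hlen : ℓ ≤ infDist (γ 0) S + dist p q + infDist (γ ℓ) S := by
    have h1 := dist_triangle4 (γ 0) p q (γ ℓ)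
    rw [dist_comm q, hq.2, hp.2, hγ 0 h0 ℓ hl, zero_sub, abs_neg, abs_of_nonneg hℓ] at h1
    exact h1
  have first : ∀ t ∈ Set.Icc 0 ℓ, t < infDist (γ 0) S - C → ∀ r ∈ nprojSet S (γ t),
      dist p r ≤ C := by
    intro t ht h1 r hr
    refine hS _ _ ?_ p hp r hr
    rwa [hγ 0 h0 t ht, zero_sub, abs_neg, abs_of_nonneg ht.1]
  have last : ∀ t ∈ Set.Icc 0 ℓ, ℓ - t < infDist (γ ℓ) S - C → ∀ r ∈ nprojSet S (γ t),
      dist q r ≤ C := by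
    intro t ht h1 r hr
    refine hS _ _ ?_ q hq r hr
    rwa [hγ ℓ hl t ht, abs_of_nonneg (by linarith [ht.2])]
  by_cases h1 : ℓ < infDist (γ 0) S - C
  · linarith [first ℓ hl h1 q hq]
  set t₁ := infDist (γ 0) S - C - 1 with ht₁
  have m₁ : t₁ ∈ Set.Icc 0 ℓ := ⟨by linarith, by linarith⟩
  obtain ⟨r, hr⟩ := hne (γ t₁)
  have d₁ := first t₁ m₁ (by linarith) r hr
  by_cases h2 : ℓ - t₁ < infDist (γ ℓ) S - C
  · have := last t₁ m₁ h2 r hr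
    rw [dist_comm] at this
    linarith [dist_triangle p r q]
  set t₂ := ℓ - (infDist (γ ℓ) S - C - 1) with ht₂
  have m₂ : t₂ ∈ Set.Icc 0 ℓ := ⟨by linarith [m₁.1], by linarith⟩
  obtain ⟨r', hr'⟩ := hne (γ t₂)
  have d₂ := last t₂ m₂ (by linarith) r' hr'
  by_cases h3 : t₂ < t₁
  · have := first t₂ m₂ (by linarith) r' hr'
    rw [dist_comm] at d₂
    linarith [dist_triangle p r' q]
  have hw : 0 < 2 * C + 1 := by linarith
  have d₃ := dist_nprojSet_le_of_far hC hne hS hγ hfar ⌊(t₂ - t₁) / (2 * C + 1)⌋₊ t₁ m₁ t₂ m₂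
    (by linarith) (by rw [← div_le_iff₀ hw]; exact (Nat.lt_floor_add_one _).le) r hr r' hr'
  have hfl : (⌊(t₂ - t₁) / (2 * C + 1)⌋₊ : ℝ) * (2 * C + 1) ≤ t₂ - t₁ := by
    rw [← le_div_iff₀ hw]
    exact Nat.floor_le (div_nonneg (by linarith) hw.le)
  rw [dist_comm] at d₂
  have hn : (0 : ℝ) ≤ ⌊(t₂ - t₁) / (2 * C + 1)⌋₊ := by positivity
  have := dist_triangle4 p r r' q
  nlinarith

theorem dist_add_dist_le_of_contracting (hGeo : GeodesicSpace X) {C : ℝ} (hC : 0 ≤ C)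
    {S : Set X} (hne : ∀ x, (nprojSet S x).Nonempty)
    (hS : ∀ x y, dist x y < infDist x S - C → ∀ p ∈ nprojSet S x, ∀ q ∈ nprojSet S y,
      dist p q ≤ C)
    {x y p q : X} (hp : p ∈ nprojSet S x) (hq : q ∈ nprojSet S y)
    (hpq : 8 * C + 2 < dist p q) :
    dist x p + dist p y ≤ dist x y + 2 * (11 * C + 5) := by
  obtain ⟨γ, h0, h1, hγ⟩ := hGeo x y
  have hℓ : 0 ≤ dist x y := dist_nonneg
  generalize dist x y = ℓ at *
  have lip : ∀ s ∈ Set.Icc 0 ℓ, ∀ t ∈ Set.Icc 0 ℓ,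
      infDist (γ s) S ≤ infDist (γ t) S + |s - t| := fun s hs t ht =>
    hγ s hs t ht ▸ infDist_le_infDist_add_dist
  have ex : ∃ n : ℕ, (n : ℝ) ≤ ℓ ∧ infDist (γ n) S ≤ 3 * C + 3 := by
    by_contra! hcon
    refine absurd (dist_nprojSet_le_of_geodesic_far hC hℓ hne hS hγ (fun t ht => ?_)
      (h0 ▸ hp) (h1 ▸ hq)) (not_le.2 hpq)
    have hf := Nat.floor_le ht.1
    have hf' := Nat.lt_floor_add_one t
    have h2 := hcon ⌊t⌋₊ (hf.trans ht.2)
    have h3 := lip ⌊t⌋₊ ⟨by positivity, hf.trans ht.2⟩ t ht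
    rw [abs_sub_comm, abs_of_nonneg (by linarith)] at h3
    linarith
  classical
  have hn := Nat.find_spec ex
  have hmin := fun m (hm : m < Nat.find ex) => Nat.find_min ex hm
  generalize Nat.find ex = n at hn hmin
  obtain ⟨hnl, hnS⟩ := hn
  have hnm : (n : ℝ) ∈ Set.Icc 0 ℓ := ⟨by positivity, hnl⟩
  have hxz : dist x (γ n) = n := by
    rw [← h0, hγ 0 ⟨le_rfl, hℓ⟩ n hnm, zero_sub, abs_neg, abs_of_nonneg hnm.1]
  have hzy : dist (γ n) y = ℓ - n := by
    rw [← h1, hγ n hnm ℓ ⟨hℓ, le_rfl⟩, abs_sub_comm, abs_of_nonneg (by linarith)]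
  suffices dist (γ n) p ≤ 11 * C + 5 by
    have h2 := dist_triangle x (γ n) p
    have h3 := dist_triangle p (γ n) y
    rw [dist_comm p (γ n)] at h3
    linarith
  rcases Nat.eq_zero_or_pos n with rfl | hpos
  · rw [Nat.cast_zero, h0] at hnS ⊢
    rw [hp.2]
    linarith
  obtain ⟨r, hr⟩ := hne (γ n)
  have hpr : dist p r ≤ 8 * C + 2 := by
    refine dist_nprojSet_le_of_geodesic_far (γ := γ) hC hnm.1 hne hS
      (fun s hs t ht => hγ s ⟨hs.1, hs.2.trans hnl⟩ t ⟨ht.1, ht.2.trans hnl⟩) (fun t ht => ?_)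
      (h0 ▸ hp) hr
    obtain ⟨m, hm, h2, h3⟩ : ∃ m : ℕ, m < n ∧ (m : ℝ) ≤ t ∧ t ≤ m + 1 := by
      rcases ht.2.lt_or_eq with h | h
      · exact ⟨⌊t⌋₊, (Nat.floor_lt ht.1).2 h, Nat.floor_le ht.1, (Nat.lt_floor_add_one t).le⟩
      · refine ⟨n - 1, by omega, ?_, ?_⟩ <;> rw [h, Nat.cast_sub hpos] <;> simp
    have h4 : (m : ℝ) ≤ ℓ := by linarith [ht.2]
    have h5 : ¬ infDist (γ m) S ≤ 3 * C + 3 := fun h => hmin m hm ⟨h4, h⟩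
    have h6 := lip m ⟨by positivity, h4⟩ t ⟨ht.1, ht.2.trans hnl⟩
    rw [abs_sub_comm, abs_of_nonneg (by linarith)] at h6
    linarith
  have := dist_triangle (γ n) r p
  rw [hr.2, dist_comm r] at this
  linarith

theorem ProjectionBottleneck.of_contracting (hGeo : GeodesicSpace X) {C : ℝ} (hC : 0 ≤ C)
    {S : Set X} (hne : ∀ x, (nprojSet S x).Nonempty)
    (hS : ∀ x y, dist x y < infDist x S - C → ∀ p ∈ nprojSet S x, ∀ q ∈ nprojSet S y,
      dist p q ≤ C) : ProjectionBottleneck (4 * (11 * C + 5)) S := by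
  refine ⟨hne, fun x y p q hp hq hpq => ?_⟩
  have h1 := dist_add_dist_le_of_contracting hGeo hC hne hS hp hq (by linarith)
  have h2 := dist_add_dist_le_of_contracting hGeo hC hne hS hq (mem_nprojSet_self hp.1)
    (by rw [dist_comm]; linarith)
  rw [dist_comm y q, dist_comm q p, dist_comm y p] at h2
  linarith

/-! ### Orbits of infinite cyclic groups -/

theorem finite_setOf_dist_smul_le [ProperSpace X] (hPD : ProperlyDiscontinuousAction G X)
    (o : X) (R : ℝ) : {g : G | dist o (g • o) ≤ R}.Finite := by
  refine (hPD _ (isCompact_closedBall o R)).subset fun g (hg : dist o (g • o) ≤ R) => ?_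
  refine ⟨g • o, ⟨o, mem_closedBall_self (dist_nonneg.trans hg), rfl⟩, ?_⟩
  rwa [mem_closedBall, dist_comm]

theorem finite_setOf_dist_zpow_smul_le [ProperSpace X] (hPD : ProperlyDiscontinuousAction G X)
    (o : X) {h : G} (hh : ¬ IsOfFinOrder h) (R : ℝ) : {i : ℤ | dist o (h ^ i • o) ≤ R}.Finite :=
  (finite_setOf_dist_smul_le hPD o R).preimage (injective_zpow_iff_not_isOfFinOrder.2 hh).injOn

theorem exists_lt_dist_zpow_smul [ProperSpace X] (hPD : ProperlyDiscontinuousAction G X)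
    (o : X) {h : G} (hh : ¬ IsOfFinOrder h) (R : ℝ) : ∃ n : ℕ, 2 ≤ n ∧ R < dist o (h ^ n • o) := by
  by_contra! hcon
  refine (finite_setOf_dist_zpow_smul_le hPD o hh R).not_infinite
    (((Set.Ici_infinite 2).image (Nat.cast_injective (R := ℤ)).injOn).mono ?_)
  rintro _ ⟨n, hn, rfl⟩
  simpa using hcon n hn

theorem dist_zpow_smul_zpow_smul [IsIsometricSMul G X] (o : X) (h : G) (i j : ℤ) :
    dist (h ^ i • o) (h ^ j • o) = dist o (h ^ (j - i) • o) := by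
  rw [← dist_smul (h ^ i) o, smul_smul, ← zpow_add, add_sub_cancel]

theorem dist_zpow_smul_le [IsIsometricSMul G X] (o : X) (h : G) (i j : ℤ) :
    dist (h ^ i • o) (h ^ j • o) ≤ |(i : ℝ) - j| * dist o (h • o) := by
  have key : ∀ n : ℕ, dist o (h ^ n • o) ≤ n * dist o (h • o) := by
    intro n
    induction n with
    | zero => simp
    | succ n ih =>
      have := dist_triangle o (h ^ n • o) (h ^ (n + 1) • o)
      rw [pow_succ, mul_smul, dist_smul] at this
      rw [pow_succ, mul_smul]
      push_cast
      linarith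
  wlog hij : i ≤ j generalizing i j
  · rw [dist_comm, abs_sub_comm]
    exact this j i (by omega)
  obtain ⟨n, rfl⟩ := Int.le.dest hij
  rw [dist_zpow_smul_zpow_smul, add_sub_cancel_left, zpow_natCast]
  simpa using key n

theorem zpow_smul_mem_zOrbit {G X : Type*} [Group G] [MulAction G X] (o : X) (h : G) (i : ℤ) :
    h ^ i • o ∈ zOrbit o h := ⟨i, rfl⟩

theorem mem_zOrbit_self {G X : Type*} [Group G] [MulAction G X] (o : X) (h : G) :
    o ∈ zOrbit o h := ⟨0, by simp⟩

theorem zpow_smul_zOrbit {G X : Type*} [Group G] [MulAction G X] (o : X) (h : G) (k : ℤ) :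
    h ^ k • zOrbit o h = zOrbit o h := by
  ext x
  constructor
  · rintro ⟨_, ⟨i, rfl⟩, rfl⟩
    exact ⟨k + i, by simp [zpow_add, mul_smul]⟩
  · rintro ⟨i, rfl⟩
    exact ⟨h ^ (i - k) • o, ⟨_, rfl⟩, by simp [smul_smul, ← zpow_add]⟩

theorem nprojSet_zOrbit_nonempty [ProperSpace X] (hPD : ProperlyDiscontinuousAction G X)
    (o : X) {h : G} (hh : ¬ IsOfFinOrder h) (x : X) : (nprojSet (zOrbit o h) x).Nonempty := by
  have hfin : {i : ℤ | dist x (h ^ i • o) ≤ dist x o}.Finite := by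
    refine (finite_setOf_dist_zpow_smul_le hPD o hh (2 * dist x o)).subset fun i hi => ?_
    have := dist_triangle_left o (h ^ i • o) x
    simp only [Set.mem_ofPred_eq] at hi ⊢
    linarith
  obtain ⟨i, hi, hmin⟩ := Set.exists_min_image _ (fun i : ℤ => dist x (h ^ i • o)) hfin
    ⟨0, by simp⟩
  refine ⟨h ^ i • o, ⟨i, rfl⟩, le_antisymm ?_ (infDist_le_dist_of_mem ⟨i, rfl⟩)⟩
  rw [le_infDist ⟨o, mem_zOrbit_self o h⟩]
  rintro _ ⟨j, rfl⟩
  by_cases hj : dist x (h ^ j • o) ≤ dist x o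
  · exact hmin j hj
  · exact hi.trans (not_le.1 hj).le

theorem isBounded_nprojSet (S : Set X) (x : X) : Bornology.IsBounded (nprojSet S x) :=
  isBounded_closedBall.subset fun p hp => by
    rw [mem_closedBall, dist_comm]
    exact hp.2.le

theorem StronglyContractingElem.exists_projectionBottleneck [ProperSpace X]
    (hGeo : GeodesicSpace X) (hPD : ProperlyDiscontinuousAction G X) {o : X} {h : G}
    (hSC : StronglyContractingElem o h) : ∃ c, 0 ≤ c ∧ ProjectionBottleneck c (zOrbit o h) := by
  obtain ⟨hh, -, C, hC, hS⟩ := hSC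
  refine ⟨_, ?_, .of_contracting hGeo hC (nprojSet_zOrbit_nonempty hPD o hh)
    fun x y hxy p hp q hq => (dist_le_diam_of_mem ?_ (.inl hp) (.inr hq)).trans (hS x y hxy)⟩
  · positivity
  · exact (isBounded_nprojSet _ x).union (isBounded_nprojSet _ y)

theorem ProjectionBottleneck.diam_le {c : ℝ} (hc : 0 ≤ c) {S : Set X}
    (hS : ProjectionBottleneck c S) {x y : X} (hxy : dist x y < infDist x S - c) :
    diam (nprojSet S x ∪ nprojSet S y) ≤ 2 * c := by
  obtain ⟨q₀, hq₀⟩ := hS.1 y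
  have key : ∀ p ∈ nprojSet S x ∪ nprojSet S y, dist p q₀ ≤ c := by
    rintro p (hp | hp) <;> by_contra! hpq
    · have := hS.2 _ _ _ _ hp hq₀ hpq
      linarith [hp.2, dist_nonneg (x := q₀) (y := y)]
    · have := hS.2 _ _ _ _ hp hq₀ hpq
      have h1 : infDist x S ≤ infDist y S + dist x y := infDist_le_infDist_add_dist
      rw [dist_self, hp.2, dist_comm q₀, hq₀.2] at this
      linarith
  refine diam_le_of_forall_dist_le (by positivity) fun p hp q hq => ?_
  have := key q hq
  rw [dist_comm] at this
  linarith [dist_triangle p q₀ q, key p hp]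

theorem ProjectionBottleneck.of_subset {c D : ℝ} {S S' : Set X}
    (hS : ProjectionBottleneck c S) (hne : ∀ x, (nprojSet S' x).Nonempty) (hsub : S' ⊆ S)
    (hD : ∀ a ∈ S, ∃ b ∈ S', dist a b ≤ D) :
    ProjectionBottleneck (5 * c + 4 * D) S' := by
  have near : ∀ x, ∀ p ∈ nprojSet S x, ∀ p' ∈ nprojSet S' x, dist p p' ≤ c + D := by
    intro x p hp p' hp'
    obtain ⟨b, hb, hpb⟩ := hD p hp.1
    have h1 := hS.dist_add_dist_le hp (hsub hp'.1)
    have h2 := dist_le_of_mem_nprojSet hp' hb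
    linarith [dist_triangle x p b]
  refine ⟨hne, fun x y p' q' hp' hq' hpq => ?_⟩
  obtain ⟨p, hp⟩ := hS.1 x
  obtain ⟨q, hq⟩ := hS.1 y
  have h1 := near x p hp p' hp'
  have h2 := near y q hq q' hq'
  have h3 := dist_triangle4 p' p q q'
  have h4 := dist_triangle x p p'
  have h5 := dist_triangle q' q y
  rw [dist_comm p' p] at h3
  rw [dist_comm q' q] at h5
  have := hS.2 _ _ _ _ hp hq (by linarith [dist_nonneg (x := p) (y := p')])
  linarith

theorem StronglyContractingElem.zpow [ProperSpace X] [IsIsometricSMul G X]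
    (hGeo : GeodesicSpace X) (hPD : ProperlyDiscontinuousAction G X) {o : X} {h : G}
    (hSC : StronglyContractingElem o h) {m : ℤ} (hm : m ≠ 0) :
    StronglyContractingElem o (h ^ m) := by
  obtain ⟨c, hc, hS⟩ := hSC.exists_projectionBottleneck hGeo hPD
  obtain ⟨hh, ⟨M, C, hM, hC, hQ⟩, -⟩ := hSC
  have hinj := injective_zpow_iff_not_isOfFinOrder.2 hh
  have hh' : ¬ IsOfFinOrder (h ^ m) := by
    rw [← injective_zpow_iff_not_isOfFinOrder]
    intro i j hij
    simp only [← zpow_mul] at hij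
    exact mul_left_cancel₀ hm (hinj hij)
  have hm1 : (1 : ℝ) ≤ |(m : ℝ)| := by exact_mod_cast Int.one_le_abs hm
  refine ⟨hh', ⟨M * |(m : ℝ)|, C, by nlinarith, hC, fun i j => ?_⟩, ?_⟩
  · have h1 := hQ (m * i) (m * j)
    push_cast at h1
    rw [← mul_sub, abs_mul, zpow_mul, zpow_mul] at h1
    refine ⟨le_trans ?_ h1.1, by linarith [h1.2]⟩
    have h2 : 1 / (M * |(m : ℝ)|) ≤ 1 / M :=
      one_div_le_one_div_of_le (by linarith) (by nlinarith)
    have h3 : 0 < 1 / M := by positivity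
    have h4 := abs_nonneg ((i : ℝ) - j)
    gcongr
    nlinarith
  · have hS' : ProjectionBottleneck _ (zOrbit o (h ^ m)) :=
      hS.of_subset (D := |(m : ℝ)| * dist o (h • o)) (nprojSet_zOrbit_nonempty hPD o hh')
        (by rintro _ ⟨i, rfl⟩; exact ⟨m * i, by simp [zpow_mul]⟩) (by
          rintro _ ⟨i, rfl⟩
          refine ⟨(h ^ m) ^ (i / m) • o, ⟨_, rfl⟩, ?_⟩
          dsimp only
          rw [← zpow_mul]
          refine (dist_zpow_smul_le o h _ _).trans
            (mul_le_mul_of_nonneg_right ?_ dist_nonneg)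
          have h1 : i - m * (i / m) = i % m := by rw [Int.emod_def]
          have h2 : |i - m * (i / m)| ≤ |m| := by
            rw [h1, abs_of_nonneg (Int.emod_nonneg i hm)]
            exact (Int.emod_lt_abs i hm).le
          exact_mod_cast h2)
    have hc' : 0 ≤ 5 * c + 4 * (|(m : ℝ)| * dist o (h • o)) := by positivity
    refine ⟨2 * (5 * c + 4 * (|(m : ℝ)| * dist o (h • o))), by positivity, fun x y hxy =>
      hS'.diam_le hc' (by linarith)⟩

/-! ### Elements with separated translates -/

/-- `U x k` says that `x` lies beyond `f ^ k • o`. If `f ^ k • o` is coarsely between any two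
points that it separates in this sense, then `f` is strongly contracting. -/
theorem stronglyContractingElem_of_separation [ProperSpace X] [IsIsometricSMul G X]
    (hPD : ProperlyDiscontinuousAction G X) (o : X) (f : G) {c : ℝ} (hc : 0 ≤ c)
    (U : X → ℤ → Prop) (hlt : ∀ i k : ℤ, k < i → U (f ^ i • o) k)
    (hgt : ∀ i k : ℤ, i < k → ¬ U (f ^ i • o) k)
    (hsep : ∀ x y k, ¬ U x k → U y (k + 1) →
      dist x (f ^ k • o) + dist (f ^ k • o) y ≤ dist x y + c) :
    StronglyContractingElem o f := by
  have hf : ¬ IsOfFinOrder f := by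
    rw [isOfFinOrder_iff_pow_eq_one]
    rintro ⟨n, hn, h1⟩
    refine hgt 0 1 one_pos ?_
    have := hlt (2 * n : ℕ) 1 (by push_cast; omega)
    rwa [zpow_natCast, mul_comm, pow_mul, h1, one_pow, ← zpow_zero f] at this
  obtain ⟨m, hm2, hm⟩ := exists_lt_dist_zpow_smul hPD o hf (c + 1)
  have hlin : ∀ k : ℕ, (k : ℝ) ≤ dist o (f ^ (m * k) • o) := by
    intro k
    induction k with
    | zero => simp
    | succ k ih =>
      rcases Nat.eq_zero_or_pos k with rfl | hk
      · simp only [zero_add, mul_one, Nat.cast_one]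
        linarith
      · have hpos : 0 < m * k := by positivity
        have h1 := hsep o (f ^ ((m * (k + 1) : ℕ) : ℤ) • o) ((m * k : ℕ) : ℤ)
          (by simpa using hgt 0 ((m * k : ℕ) : ℤ) (by omega))
          (hlt _ _ (by rw [mul_add]; push_cast; omega))
        rw [dist_zpow_smul_zpow_smul, ← Nat.cast_sub (by rw [mul_add]; omega)] at h1
        simp only [zpow_natCast] at h1
        rw [show m * (k + 1) - m * k = m by rw [mul_add]; omega] at h1
        push_cast
        linarith
  set a := dist o (f • o) with ha
  have ha0 : 0 ≤ a := dist_nonneg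
  have hm0 : (0 : ℝ) < m := by positivity
  have hlow : ∀ n : ℕ, (n : ℝ) / m - (1 + m * a) ≤ dist o (f ^ n • o) := by
    intro n
    have h1 := hlin (n / m)
    have h2 := dist_zpow_smul_le o f ((m * (n / m) : ℕ) : ℤ) (n : ℤ)
    have h3 := Nat.div_add_mod n m
    have h4 := Nat.mod_lt n (show 0 < m by omega)
    have h5 : ((m : ℝ) * (n / m : ℕ)) + (n % m : ℕ) = n := by exact_mod_cast h3
    have h6 : ((n % m : ℕ) : ℝ) ≤ m := by exact_mod_cast h4.le
    have h7 : |(((m * (n / m) : ℕ) : ℤ) : ℝ) - ((n : ℤ) : ℝ)| ≤ m := by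
      simp only [Int.cast_natCast, Nat.cast_mul, Int.cast_mul]
      rw [abs_sub_comm, abs_of_nonneg (by linarith [Nat.cast_nonneg (α := ℝ) (n % m)])]
      linarith
    simp only [zpow_natCast] at h2
    have h8 : (n : ℝ) / m ≤ (n / m : ℕ) + 1 := by
      rw [div_le_iff₀ hm0]
      linarith
    have h9 := mul_le_mul_of_nonneg_right h7 ha0
    have := dist_triangle o (f ^ n • o) (f ^ (m * (n / m)) • o)
    rw [dist_comm (f ^ n • o)] at this
    linarith
  have hlowZ : ∀ i j : ℤ, |(i : ℝ) - j| / m - (1 + m * a) ≤ dist (f ^ i • o) (f ^ j • o) := by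
    intro i j
    wlog hij : i ≤ j generalizing i j
    · rw [dist_comm, abs_sub_comm]
      exact this j i (by omega)
    obtain ⟨n, rfl⟩ := Int.le.dest hij
    rw [dist_zpow_smul_zpow_smul, add_sub_cancel_left, zpow_natCast]
    simpa using hlow n
  refine ⟨hf, ⟨m + a, 1 + m * a, ?_, by positivity, fun i j => ⟨?_, ?_⟩⟩, ?_⟩
  · have : (2 : ℝ) ≤ m := by exact_mod_cast hm2
    linarith
  · refine le_trans ?_ (hlowZ i j)
    rw [div_eq_inv_mul _ (m : ℝ), one_div]
    gcongr
    exact le_add_of_nonneg_right ha0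
  · refine (dist_zpow_smul_le o f i j).trans ?_
    rw [← ha]
    nlinarith [abs_nonneg ((i : ℝ) - j), mul_nonneg hm0.le ha0,
      mul_nonneg (abs_nonneg ((i : ℝ) - j)) hm0.le]
  obtain ⟨N, hN⟩ := exists_nat_gt ((c + (1 + m * a)) * m)
  have hfar : ∀ i j : ℤ, (N : ℤ) ≤ |i - j| → c < dist (f ^ i • o) (f ^ j • o) := by
    intro i j hij
    have h1 : (N : ℝ) ≤ |(i : ℝ) - j| := by exact_mod_cast hij
    have h2 := hlowZ i j
    have h3 : c + (1 + m * a) < |(i : ℝ) - j| / m := by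
      rw [lt_div_iff₀ hm0]
      linarith
    linarith
  have hN0 : 0 < N := by
    have : (0 : ℝ) < N := lt_of_le_of_lt (by positivity) hN
    exact_mod_cast this
  have hpos : ∀ (x : X) (i : ℤ), f ^ i • o ∈ nprojSet (zOrbit o f) x →
      (∀ k : ℤ, i + N + 1 ≤ k → ¬ U x k) ∧ ∀ k : ℤ, k ≤ i - N - 2 → U x k := by
    intro x i hi
    constructor
    · intro k hk hU
      have h1 := hsep (f ^ i • o) x (k - 1) (hgt _ _ (by omega)) (by simpa using hU)
      have h2 := dist_le_of_mem_nprojSet hi (zpow_smul_mem_zOrbit o f (k - 1))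
      have h3 := hfar i (k - 1) (by rw [abs_sub_comm, abs_of_nonneg] <;> omega)
      rw [dist_comm _ x, dist_comm _ x] at h1
      linarith
    · intro k hk
      by_contra hU
      have h1 := hsep x (f ^ i • o) k hU (hlt _ _ (by omega))
      have h2 := dist_le_of_mem_nprojSet hi (zpow_smul_mem_zOrbit o f k)
      have h3 := hfar k i (by rw [abs_sub_comm, abs_of_nonneg] <;> omega)
      linarith
  have hclose : ∀ (x y : X) (i j : ℤ), dist x y < infDist x (zOrbit o f) - c →
      f ^ i • o ∈ nprojSet (zOrbit o f) x → f ^ j • o ∈ nprojSet (zOrbit o f) y →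
      |i - j| ≤ 2 * N + 4 := by
    intro x y i j hxy hi hj
    have hk : ∀ k : ℤ, infDist x (zOrbit o f) ≤ dist x (f ^ k • o) := fun k =>
      infDist_le_dist_of_mem (zpow_smul_mem_zOrbit o f k)
    by_contra! hcon
    rcases lt_abs.1 hcon with h | h
    · have h1 := hsep y x (j + N + 1) ((hpos y j hj).1 _ le_rfl)
        ((hpos x i hi).2 _ (by linarith))
      rw [dist_comm _ x, dist_comm y x] at h1
      linarith [hk (j + N + 1), dist_nonneg (x := y) (y := f ^ (j + N + 1) • o)]
    · have h1 := hsep x y (i + N + 1) ((hpos x i hi).1 _ le_rfl)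
        ((hpos y j hj).2 _ (by linarith))
      linarith [hk (i + N + 1), dist_nonneg (x := f ^ (i + N + 1) • o) (y := y)]
  have hcloseD : ∀ x y, dist x y < infDist x (zOrbit o f) - c →
      ∀ p ∈ nprojSet (zOrbit o f) x, ∀ q ∈ nprojSet (zOrbit o f) y,
        dist p q ≤ (2 * N + 4) * a := by
    intro x y hxy p hp q hq
    obtain ⟨i, rfl⟩ := hp.1
    obtain ⟨j, rfl⟩ := hq.1
    refine (dist_zpow_smul_le o f i j).trans (mul_le_mul_of_nonneg_right ?_ ha0)
    exact_mod_cast hclose x y i j hxy hp hq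
  have hb : (0 : ℝ) ≤ (2 * N + 4) * a := by positivity
  refine ⟨2 * (c + (2 * N + 4) * a), by positivity, fun x y hxy =>
    diam_le_of_forall_dist_le (by positivity) ?_⟩
  have hxy' : dist x y < infDist x (zOrbit o f) - c := by linarith
  have h0 : dist x x < infDist x (zOrbit o f) - c := by
    rw [dist_self]
    linarith [dist_nonneg (x := x) (y := y)]
  obtain ⟨p₀, hp₀⟩ := nprojSet_zOrbit_nonempty hPD o hf x
  have key : ∀ p ∈ nprojSet (zOrbit o f) x ∪ nprojSet (zOrbit o f) y,
      dist p₀ p ≤ (2 * N + 4) * a := by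
    rintro p (hp | hp)
    · exact hcloseD x x h0 _ hp₀ _ hp
    · exact hcloseD x y hxy' _ hp₀ _ hp
  intro p hp q hq
  linarith [dist_triangle_left p q p₀, key p hp, key q hq]

theorem stronglyContractingElem_of_projectsNear [ProperSpace X] [IsIsometricSMul G X]
    (hPD : ProperlyDiscontinuousAction G X) {o b : X} {f : G} {S : Set X} {c T : ℝ}
    (hc : 0 ≤ c) (hT : 0 ≤ T) (hS : ProjectionBottleneck c S) (ho : o ∈ S)
    (h₁ : ProjectsNear S (f • S) o T) (h₂ : ProjectsNear (f • S) S (f • b) T)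
    (hb : 2 * T + 3 * c < dist o b) : StronglyContractingElem o f := by
  let U : X → ℤ → Prop := fun x k => ∃ p ∈ nprojSet S (f ^ (-k) • x), T + c < dist p b
  have hshift : ∀ (x : X) (k : ℤ), f ^ (-k) • x = f • f ^ (-(k + 1)) • x := by
    intro x k
    rw [smul_smul, ← zpow_one_add]
    congr 2
    ring
  have hnear : ∀ (x : X) (k : ℤ), U x (k + 1) →
      ∀ p ∈ nprojSet S (f ^ (-k) • x), dist p o ≤ T + c := by
    rintro x k ⟨q, hq, hqb⟩ p hp
    have hq' := smul_mem_nprojSet_smul f hq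
    rw [← hshift] at hq'
    obtain ⟨r, hr⟩ := hS.1 (f • q)
    obtain ⟨s, hs⟩ := (hS.smul f).1 p
    have hro := h₁ _ hq'.1 r hr
    have hsb := h₂ p hp.1 s hs
    rcases hS.behrstock (hS.smul f) hp hq' hr hs with h | h
    · linarith [dist_triangle p r o]
    · have := dist_triangle (f • q) s (f • b)
      rw [dist_smul] at this
      linarith
  have hofar : ∀ (x : X) (k : ℤ), (∀ p ∈ nprojSet S (f ^ (-k) • x), dist p o ≤ T + c) → U x k := by
    intro x k hk
    obtain ⟨p, hp⟩ := hS.1 (f ^ (-k) • x)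
    exact ⟨p, hp, by linarith [hk p hp, dist_triangle_left o b p]⟩
  have hdown : ∀ (x : X) (k : ℤ) (n : ℕ), U x (k + n) → U x k := by
    intro x k n
    induction n with
    | zero => simp
    | succ n ih =>
      intro h
      push_cast at h
      rw [← add_assoc] at h
      exact ih (hofar _ _ (hnear _ _ h))
  refine stronglyContractingElem_of_separation hPD o f (c := 2 * T + 3 * c) (by positivity) U
    (fun i k hki => ?_) (fun i k hik hU => ?_) (fun x y k hx hy => ?_)
  · obtain ⟨n, hn⟩ := Int.le.dest (show k ≤ i - 1 by omega)
    refine hdown _ _ n (hn ▸ hofar _ _ fun p hp => ?_)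
    rw [smul_smul, ← zpow_add, show -(i - 1) + i = 1 by ring, zpow_one] at hp
    linarith [h₁ _ (Set.smul_mem_smul_set ho) p hp]
  · obtain ⟨n, rfl⟩ := Int.le.dest (show i + 1 ≤ k by omega)
    obtain ⟨p, hp, hpb⟩ := hdown _ _ n hU
    have hp' := smul_mem_nprojSet_smul f hp
    rw [← hshift, smul_smul, ← zpow_add, neg_add_cancel, zpow_zero, one_smul] at hp'
    have := h₂ o ho _ hp'
    rw [dist_smul] at this
    linarith
  · obtain ⟨p, hp⟩ := hS.1 (f ^ (-k) • x)
    obtain ⟨q, hq⟩ := hS.1 (f ^ (-k) • y)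
    have hpb : dist p b ≤ T + c := not_lt.1 fun h => hx ⟨p, hp, h⟩
    have hqo := hnear y k hy q hq
    have h3 := dist_triangle4 o q p b
    rw [dist_comm o q, dist_comm q p] at h3
    have h4 := hS.2 _ _ _ _ hp hq (by linarith)
    have hxo : dist x (f ^ k • o) = dist (f ^ (-k) • x) o := by
      rw [← dist_smul (f ^ (-k)) x, smul_smul, ← zpow_add, neg_add_cancel, zpow_zero, one_smul]
    have hoy : dist (f ^ k • o) y = dist o (f ^ (-k) • y) := by
      rw [← dist_smul (f ^ (-k)) _ y, smul_smul, ← zpow_add, neg_add_cancel, zpow_zero, one_smul]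
    rw [dist_smul] at h4
    rw [hxo, hoy]
    have h5 := dist_triangle4 (f ^ (-k) • x) p q o
    have h6 := dist_triangle_left o (f ^ (-k) • y) q
    linarith

/-! ### Translates with unbounded projection -/

theorem exists_zpow_dist_le_of_between [IsIsometricSMul G X] {o : X} {h g : G} {c : ℝ}
    (hS : ProjectionBottleneck c (zOrbit o h)) {x y p q z : X}
    (hx : x ∈ g • zOrbit o h) (hy : y ∈ g • zOrbit o h) (hp : p ∈ nprojSet (zOrbit o h) x)
    (hq : q ∈ nprojSet (zOrbit o h) y) (hpq : c < dist p q)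
    (hz : dist p z + dist z q = dist p q) :
    ∃ s t : ℤ, dist z (h ^ s • o) ≤ c ∧ 2 * dist (h ^ s • o) (g • h ^ t • o) ≤ 5 * c := by
  obtain ⟨r, hr⟩ := hS.1 z
  obtain ⟨r', hr'⟩ := (hS.smul g).1 z
  have h1 := hS.dist_le_of_between hp.1 hq.1 hr (e := 0) (by linarith)
  have h2 := hS.2 _ _ _ _ hp hq hpq
  have h3 := (hS.smul g).dist_le_of_between hx hy hr' (e := c)
    (by linarith [dist_triangle x p z, dist_triangle z q y])
  obtain ⟨s, rfl⟩ := hr.1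
  obtain ⟨_, ⟨t, rfl⟩, rfl⟩ := hr'.1
  refine ⟨s, t, by linarith, ?_⟩
  have := dist_triangle_left (h ^ s • o) (g • h ^ t • o) z
  dsimp only at h1 h3 this ⊢
  linarith

theorem exists_conj_zpow_eq_of_unbounded [ProperSpace X] [IsIsometricSMul G X]
    (hGeo : GeodesicSpace X) (hPD : ProperlyDiscontinuousAction G X) {o : X} {h g : G} {c : ℝ}
    (hc : 0 ≤ c) (hS : ProjectionBottleneck c (zOrbit o h))
    (hg : ∀ T, ∃ x ∈ g • zOrbit o h, ∃ y ∈ g • zOrbit o h,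
      ∃ p ∈ nprojSet (zOrbit o h) x, ∃ q ∈ nprojSet (zOrbit o h) y, T < dist p q) :
    (∃ s t : ℤ, 2 * dist (h ^ s • o) (g • h ^ t • o) ≤ 5 * c) ∧
      ∃ a b : ℤ, b ≠ 0 ∧ g * h ^ a * g⁻¹ = h ^ b := by
  have hF := finite_setOf_dist_smul_le hPD o (5 * c / 2)
  set N := hF.toFinset.card with hN
  obtain ⟨x, hx, y, hy, p, hp, q, hq, hpq⟩ := hg (N * (2 * c + 1) + c)
  obtain ⟨γ, h0, h1, hγ⟩ := hGeo p q
  have hNc : 0 ≤ N * (2 * c + 1) := by positivity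
  have hmem : ∀ i ∈ Finset.range (N + 1), (i : ℝ) * (2 * c + 1) ∈ Set.Icc 0 (dist p q) := by
    intro i hi
    have hi' : (i : ℝ) ≤ N := by exact_mod_cast Nat.lt_succ_iff.1 (Finset.mem_range.1 hi)
    exact ⟨by positivity, by nlinarith⟩
  have hpt : ∀ i ∈ Finset.range (N + 1), ∃ s t : ℤ,
      dist (γ (i * (2 * c + 1))) (h ^ s • o) ≤ c ∧
        2 * dist (h ^ s • o) (g • h ^ t • o) ≤ 5 * c := by
    intro i hi
    have hi' := hmem i hi
    refine exists_zpow_dist_le_of_between hS hx hy hp hq (by linarith) ?_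
    have e1 := hγ 0 ⟨le_rfl, dist_nonneg⟩ _ hi'
    have e2 := hγ _ hi' _ ⟨dist_nonneg, le_rfl⟩
    rw [h0, zero_sub, abs_neg, abs_of_nonneg hi'.1] at e1
    rw [h1, abs_sub_comm, abs_of_nonneg (by linarith [hi'.2])] at e2
    linarith
  choose! s t hs ht using hpt
  refine ⟨⟨s 0, t 0, ht 0 (by simp)⟩, ?_⟩
  obtain ⟨i, hi, j, hj, hij, he⟩ := Finset.exists_ne_map_eq_of_card_lt_of_maps_to
    (s := Finset.range (N + 1)) (t := hF.toFinset)
    (f := fun i => (h ^ s i)⁻¹ * g * h ^ t i) (by simp [hN]) (fun i hi => by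
      simp only [Finset.mem_coe, Set.Finite.mem_toFinset, Set.mem_ofPred_eq]
      rw [← dist_smul (h ^ s i)]
      simp only [smul_smul, ← mul_assoc, mul_inv_cancel, one_mul]
      have := ht i hi
      rw [smul_smul] at this
      linarith)
  refine ⟨t i - t j, s i - s j, fun h0 => ?_, ?_⟩
  · have e1 := hs i hi
    have e2 := hs j hj
    rw [← sub_eq_zero.1 h0, dist_comm] at e2
    have e3 := dist_triangle_left (γ (j * (2 * c + 1))) (γ (i * (2 * c + 1))) (h ^ s i • o)
    rw [dist_comm (h ^ s i • o), dist_comm (h ^ s i • o)] at e3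
    rw [dist_comm] at e2
    rw [hγ _ (hmem j hj) _ (hmem i hi), ← sub_mul, abs_mul,
      abs_of_nonneg (show 0 ≤ 2 * c + 1 by linarith)] at e3
    have e4 : (1 : ℝ) ≤ |(j : ℝ) - i| := by
      have := Int.one_le_abs (sub_ne_zero.2 ((Nat.cast_injective (R := ℤ)).ne hij.symm))
      exact_mod_cast this
    nlinarith
  · have he' : g * h ^ t i = h ^ s i * ((h ^ s j)⁻¹ * g * h ^ t j) := by
      rw [← he]
      group
    calc g * h ^ (t i - t j) * g⁻¹ = g * h ^ t i * (h ^ t j)⁻¹ * g⁻¹ := by group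
      _ = h ^ (s i - s j) := by rw [he']; group

theorem finite_setOf_commute_zpow {G : Type*} [Group G] {h : G} {Γ : Subgroup G} (hN : Γ.Normal)
    (hΓ : ∀ m : ℤ, h ^ m ∈ Γ → m = 0) (u : G) :
    {g | g ∈ Γ ∧ (∃ a : ℤ, a ≠ 0 ∧ Commute g (h ^ a)) ∧
      ∃ s t : ℤ, (h ^ s)⁻¹ * g * h ^ t = u}.Finite := by
  rcases Set.eq_empty_or_nonempty {g | g ∈ Γ ∧ (∃ a : ℤ, a ≠ 0 ∧ Commute g (h ^ a)) ∧
      ∃ s t : ℤ, (h ^ s)⁻¹ * g * h ^ t = u} with hE | ⟨g₀, hg₀, ⟨a, ha, hcomm⟩, s₀, t₀, hu₀⟩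
  · rw [hE]
    exact Set.finite_empty
  refine ((Set.finite_Ico 0 |a|).image fun r : ℤ => h ^ r * g₀ * (h ^ r)⁻¹).subset ?_
  rintro g ⟨hg, -, s, t, hu⟩
  have hconj : (h ^ t)⁻¹ * g * h ^ t = (h ^ t₀)⁻¹ * g₀ * h ^ t₀ := by
    have e1 : (h ^ t)⁻¹ * g * h ^ t = h ^ (s - t) * u := by rw [← hu]; group
    have e2 : (h ^ t₀)⁻¹ * g₀ * h ^ t₀ = h ^ (s₀ - t₀) * u := by rw [← hu₀]; group
    have m1 : (h ^ t)⁻¹ * g * h ^ t ∈ Γ := by simpa using hN.conj_mem g hg (h ^ t)⁻¹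
    have m2 : (h ^ t₀)⁻¹ * g₀ * h ^ t₀ ∈ Γ := by simpa using hN.conj_mem g₀ hg₀ (h ^ t₀)⁻¹
    rw [e1] at m1 ⊢
    rw [e2] at m2 ⊢
    have m3 := hΓ ((s - t) - (s₀ - t₀)) (by
      have := Γ.mul_mem m1 (Γ.inv_mem m2)
      rwa [mul_inv_rev, mul_assoc, mul_inv_cancel_left, ← zpow_neg, ← zpow_add,
        ← sub_eq_add_neg] at this)
    rw [sub_eq_zero.1 m3]
  have hg' : g = h ^ (t - t₀) * g₀ * (h ^ (t - t₀))⁻¹ := by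
    calc g = h ^ t * ((h ^ t)⁻¹ * g * h ^ t) * (h ^ t)⁻¹ := by group
      _ = _ := by rw [hconj]; group
  refine ⟨(t - t₀) % a, ⟨Int.emod_nonneg _ ha, Int.emod_lt_abs _ ha⟩, ?_⟩
  have hsplit : h ^ (t - t₀) = h ^ ((t - t₀) % a) * (h ^ a) ^ ((t - t₀) / a) := by
    rw [← zpow_mul, ← zpow_add, Int.emod_add_mul_ediv]
  have hc := (hcomm.zpow_right ((t - t₀) / a)).eq
  dsimp only
  rw [hg', hsplit, mul_inv_rev, mul_assoc (h ^ ((t - t₀) % a)) ((h ^ a) ^ ((t - t₀) / a)) g₀, ← hc]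
  group

theorem exists_mem_bounded_projection [ProperSpace X] [IsIsometricSMul G X]
    (hGeo : GeodesicSpace X) (hPD : ProperlyDiscontinuousAction G X) {o : X} {h : G} {c : ℝ}
    (hc : 0 ≤ c) (hS : ProjectionBottleneck c (zOrbit o h)) {Γ : Subgroup G} (hN : Γ.Normal)
    (hInf : (Γ : Set G).Infinite) (hΓ : ∀ m : ℤ, h ^ m ∈ Γ → m = 0) :
    ∃ g ∈ Γ, ∃ T, ∀ x ∈ g • zOrbit o h, ∀ y ∈ g • zOrbit o h,
      ∀ p ∈ nprojSet (zOrbit o h) x, ∀ q ∈ nprojSet (zOrbit o h) y, dist p q ≤ T := by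
  by_contra! hbad
  refine hInf (((finite_setOf_dist_smul_le hPD o (5 * c / 2)).biUnion fun u _ =>
    finite_setOf_commute_zpow hN hΓ u).subset fun g hg => ?_)
  obtain ⟨⟨s, t, hst⟩, a, b, hb, hab⟩ :=
    exists_conj_zpow_eq_of_unbounded hGeo hPD hc hS (hbad g hg)
  have hba : b - a = 0 := by
    refine hΓ _ ?_
    rw [zpow_sub, ← hab]
    have := Γ.mul_mem hg (hN.conj_mem _ (Γ.inv_mem hg) (h ^ a))
    simpa only [mul_assoc] using this
  obtain rfl : b = a := sub_eq_zero.1 hba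
  refine Set.mem_biUnion (x := (h ^ s)⁻¹ * g * h ^ t) ?_
    ⟨hg, ⟨b, hb, mul_inv_eq_iff_eq_mul.1 hab⟩, s, t, rfl⟩
  rw [Set.mem_ofPred_eq, ← dist_smul (h ^ s)]
  simp only [smul_smul, ← mul_assoc, mul_inv_cancel, one_mul] at hst ⊢
  linarith

theorem exists_projectsNear_of_bounded [IsIsometricSMul G X] {o : X} {g : G} {c T : ℝ}
    {S : Set X} (hc : 0 ≤ c) (hS : ProjectionBottleneck c S) (ho : o ∈ S)
    (hT : ∀ x ∈ g • S, ∀ y ∈ g • S, ∀ p ∈ nprojSet S x, ∀ q ∈ nprojSet S y, dist p q ≤ T) :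
    ∃ T', 0 ≤ T' ∧ ProjectsNear S (g • S) o T' ∧ ProjectsNear (g • S) S (g • o) T' := by
  obtain ⟨p₀, hp₀⟩ := hS.1 (g • o)
  obtain ⟨q₀, hq₀⟩ := (hS.smul g).1 o
  have hgo : g • o ∈ g • S := Set.smul_mem_smul_set ho
  have hT0 : 0 ≤ T := dist_nonneg.trans (hT _ hgo _ hgo _ hp₀ _ hp₀)
  have d1 := dist_nonneg (x := p₀) (y := o)
  have d2 := dist_nonneg (x := q₀) (y := g • o)
  refine ⟨T + 3 * c + dist p₀ o + dist q₀ (g • o), by positivity, fun y hy p hp => ?_,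
    fun y hy q hq => ?_⟩
  · linarith [hT y hy _ hgo p hp p₀ hp₀, dist_triangle p p₀ o]
  · suffices dist q q₀ ≤ T + 3 * c by linarith [dist_triangle q q₀ (g • o)]
    by_contra! hfar
    have h1 := (hS.smul g).2 _ _ _ _ hq hq₀ (by linarith)
    obtain ⟨r, hr⟩ := hS.1 q
    obtain ⟨r₀, hr₀⟩ := hS.1 q₀
    have h2 := hS.dist_le_of_between hy ho hr (e := c) (by linarith [dist_triangle q q₀ o])
    have h3 := hS.dist_le_of_between hy ho hr₀ (e := c) (by linarith [dist_triangle y q q₀])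
    have h4 := hT q hq.1 q₀ hq₀.1 r hr r₀ hr₀
    have h5 := dist_triangle4 q r r₀ q₀
    rw [dist_comm r₀] at h5
    linarith

theorem exists_mem_stronglyContractingElem [ProperSpace X] [IsIsometricSMul G X]
    (hGeo : GeodesicSpace X) (hPD : ProperlyDiscontinuousAction G X) {o : X} {h : G}
    (hSC : StronglyContractingElem o h) {Γ : Subgroup G} (hN : Γ.Normal)
    (hInf : (Γ : Set G).Infinite) : ∃ f ∈ Γ, StronglyContractingElem o f := by
  by_cases hpow : ∃ m : ℤ, m ≠ 0 ∧ h ^ m ∈ Γ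
  · obtain ⟨m, hm, hmΓ⟩ := hpow
    exact ⟨h ^ m, hmΓ, hSC.zpow hGeo hPD hm⟩
  obtain ⟨c, hc, hS⟩ := hSC.exists_projectionBottleneck hGeo hPD
  have ho := mem_zOrbit_self o h
  obtain ⟨g, hg, T₀, hT₀⟩ := exists_mem_bounded_projection hGeo hPD hc hS hN hInf
    fun m hm => by_contra fun h0 => hpow ⟨m, h0, hm⟩
  obtain ⟨T, hT, h₁₂, h₂₁⟩ := exists_projectsNear_of_bounded hc hS ho hT₀
  obtain ⟨n, -, hn⟩ := exists_lt_dist_zpow_smul hPD o hSC.1 (2 * T + 5 * c)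
  have hk : ∀ k : ℤ, h ^ k • zOrbit o h = zOrbit o h := zpow_smul_zOrbit o h
  set S := zOrbit o h
  set f := g * (h ^ n * g⁻¹ * (h ^ n)⁻¹) with hf
  have hfS : (g * h ^ n * g⁻¹) • S = f • S := by
    have := hk (-n)
    rw [zpow_neg, zpow_natCast] at this
    rw [hf, ← mul_assoc, ← mul_assoc, mul_smul _ (h ^ n)⁻¹ S, this]
  have hgS : (g * h ^ n * g⁻¹) • g • S = g • S := by
    have := hk n
    rw [zpow_natCast] at this
    rw [smul_smul, inv_mul_cancel_right, mul_smul, this]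
  have h₂₃ := h₂₁.smul (g * h ^ n * g⁻¹)
  have h₃₂ := h₁₂.smul (g * h ^ n * g⁻¹)
  rw [hfS, hgS, smul_smul, inv_mul_cancel_right] at h₂₃
  rw [hfS, hgS, show (g * h ^ n * g⁻¹) • o = f • h ^ n • o by
    rw [smul_smul, hf]; congr 1; group] at h₃₂
  have hd : dist (g • o) ((g * h ^ n) • o) = dist o (h ^ n • o) := by rw [mul_smul, dist_smul]
  refine ⟨f, Γ.mul_mem hg (hN.conj_mem _ (Γ.inv_mem hg) _),
    stronglyContractingElem_of_projectsNear hPD hc (by linarith : 0 ≤ T + c) hS ho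
      (h₁₂.chain hS (hS.smul g) h₂₁ h₂₃ (by linarith))
      (h₃₂.chain (hS.smul f) (hS.smul g) h₂₃ h₂₁ (by rw [dist_comm]; linarith))
      (by linarith)⟩

end Helpers

/-- **Proposition (abundance of strongly contracting elements).** If `G ↷ X` has a strongly
contracting element, then every infinite normal subgroup of `G` contains a strongly
contracting element. -/
theorem stronglyContracting_mem_of_infinite_normal
    {G X : Type*} [Group G] [MetricSpace X] [MulAction G X] (o : X)
    (hProp : ProperSpace X) (hGeo : GeodesicSpace X)
    (hIso : IsometricAction G X) (hPD : ProperlyDiscontinuousAction G X)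
    (h : G) (hSC : StronglyContractingElem o h)
    (Γ : Subgroup G) (hN : Γ.Normal) (hInf : (Γ : Set G).Infinite) :
    ∃ f ∈ Γ, StronglyContractingElem o f := by
  have : IsIsometricSMul G X := ⟨fun g => Isometry.of_dist_eq (hIso g)⟩
  exact exists_mem_stronglyContractingElem hGeo hPD hSC hN hInf
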